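/- Let A ∈ ℝ^{n×n} and let A·U = U·T + u·(bᵀ b̃ᵀ) hold with U = (U_q Ũ) ∈ ℝ^{n×k}, b ∈ ℝ^q, b̃ ∈ ℝ^{k−q}, where (U u) is sketch-orthonormal with respect to Ω ∈ ℝ^{d×n} and Ω is an ε-embedding (0 ≤ ε < 1) for the column span of (U u). Define the perturbation E := −u·bᵀ·(Ω·U_q)ᵀ·Ω. Then: (i) (A + E)·U = U·T + u·(0ᵀ b̃ᵀ), i.e., zeroing the first q components of the residual vector amounts to running the method on the perturbed operator A + E; and (ii) if additionally |b_i| ≤ η for all i = 1, …, q, then for every x in the column span of U, ‖E·x‖ ≤ √q·√((1+ε)/(1−ε))·η·‖x‖. -/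

import Mathlib

open Matrix

/-- Euclidean (ℓ²) norm of a vector in `Fin n → ℝ`. -/
noncomputable def eNorm {n : ℕ} (x : Fin n → ℝ) : ℝ :=
  ‖(WithLp.equiv 2 (Fin n → ℝ)).symm x‖

/-- `Ω` is an ε-embedding for the set `K ⊆ ℝⁿ`. -/
def IsEpsEmbedding {d n : ℕ} (Ω : Matrix (Fin d) (Fin n) ℝ) (ε : ℝ)
    (K : Set (Fin n → ℝ)) : Prop :=
  ∀ x ∈ K, (1 - ε) * eNorm x ^ 2 ≤ eNorm (Ω.mulVec x) ^ 2 ∧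
    eNorm (Ω.mulVec x) ^ 2 ≤ (1 + ε) * eNorm x ^ 2

/-- `M` is sketch-orthonormal w.r.t. `Ω` if `(ΩM)ᵀ(ΩM) = I`. -/
def SketchOrthonormal {d n : ℕ} {m : Type*} [Fintype m] [DecidableEq m]
    (Ω : Matrix (Fin d) (Fin n) ℝ) (M : Matrix (Fin n) m ℝ) : Prop :=
  (Ω * M)ᵀ * (Ω * M) = 1

theorem eNorm_sq' {n : ℕ} (x : Fin n → ℝ) : eNorm x ^ 2 = x ⬝ᵥ x := by
  unfold eNorm
  rw [EuclideanSpace.norm_sq_eq]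
  simp [dotProduct, sq]

theorem eNorm_nonneg' {n : ℕ} (x : Fin n → ℝ) : 0 ≤ eNorm x := norm_nonneg _

theorem stmt_17 {n q r d : ℕ} (ε : ℝ) (hε0 : 0 ≤ ε) (hε1 : ε < 1)
    (A : Matrix (Fin n) (Fin n) ℝ)
    (Uq : Matrix (Fin n) (Fin q) ℝ) (Ut : Matrix (Fin n) (Fin r) ℝ)
    (u : Fin n → ℝ) (b : Fin q → ℝ) (bt : Fin r → ℝ)
    (T : Matrix (Fin q ⊕ Fin r) (Fin q ⊕ Fin r) ℝ) (Ω : Matrix (Fin d) (Fin n) ℝ)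
    (hdec : A * fromCols Uq Ut =
      fromCols Uq Ut * T + vecMulVec u (Sum.elim b bt))
    (horth : SketchOrthonormal Ω (fromCols (fromCols Uq Ut) (replicateCol (Fin 1) u)))
    (hemb : IsEpsEmbedding Ω ε
      (Set.range (fromCols (fromCols Uq Ut) (replicateCol (Fin 1) u)).mulVec))
    (E : Matrix (Fin n) (Fin n) ℝ)
    (hE : E = -(vecMulVec u (Matrix.vecMul b ((Ω * Uq)ᵀ * Ω)))) :
    (A + E) * fromCols Uq Ut =
        fromCols Uq Ut * T + vecMulVec u (Sum.elim 0 bt) ∧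
      ∀ η : ℝ, (∀ i : Fin q, |b i| ≤ η) →
        ∀ x ∈ Set.range (fromCols Uq Ut).mulVec,
          eNorm (E.mulVec x) ≤
            Real.sqrt q * Real.sqrt ((1 + ε) / (1 - ε)) * η * eNorm x := by
  have horth' := horth
  unfold SketchOrthonormal at horth'
  have hQQ : (Ω * Uq)ᵀ * (Ω * Uq) = 1 := by
    ext i j
    have := congrFun (congrFun horth' (Sum.inl (Sum.inl i))) (Sum.inl (Sum.inl j))
    simpa [Matrix.mul_apply, Matrix.one_apply, mul_comm] using this
  have hQT : (Ω * Uq)ᵀ * (Ω * Ut) = 0 := by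
    ext i j
    have := congrFun (congrFun horth' (Sum.inl (Sum.inl i))) (Sum.inl (Sum.inr j))
    simpa [Matrix.mul_apply, Matrix.one_apply, mul_comm] using this
  have hTT : (Ω * Ut)ᵀ * (Ω * Ut) = 1 := by
    ext i j
    have := congrFun (congrFun horth' (Sum.inl (Sum.inr i))) (Sum.inl (Sum.inr j))
    simpa [Matrix.mul_apply, Matrix.one_apply, mul_comm] using this
  have huu : (Ω *ᵥ u) ⬝ᵥ (Ω *ᵥ u) = 1 := by
    have := congrFun (congrFun horth' (Sum.inr 0)) (Sum.inr 0)
    simpa [Matrix.mul_apply, Matrix.mulVec, dotProduct] using this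
  have hcomb : ((Ω * Uq)ᵀ * Ω) * fromCols Uq Ut = fromCols 1 0 := by
    rw [mul_fromCols, Matrix.mul_assoc, Matrix.mul_assoc, hQQ, hQT]
  have hbU : (b ᵥ* ((Ω * Uq)ᵀ * Ω)) ᵥ* fromCols Uq Ut = Sum.elim b 0 := by
    rw [vecMul_vecMul, hcomb, vecMul_fromCols]
    simp
  refine ⟨?_, ?_⟩
  · rw [Matrix.add_mul, hdec, hE, Matrix.neg_mul, vecMulVec_mul, hbU]
    ext i j
    rcases j with j | j <;> simp [vecMulVec_apply]
  · rintro η hη x ⟨y, rfl⟩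
    have hlow : (1 - ε) * eNorm u ^ 2 ≤ 1 := by
      have h := (hemb u ⟨Sum.elim 0 (fun _ => 1), by
        rw [fromCols_mulVec]; ext i; simp [Matrix.mulVec, dotProduct]⟩).1
      rwa [eNorm_sq' (Ω *ᵥ u), huu] at h
    have hup := (hemb (fromCols Uq Ut *ᵥ y) ⟨Sum.elim y 0, by
        rw [fromCols_mulVec]; simp⟩).2
    set y1 : Fin q → ℝ := y ∘ Sum.inl with hy1
    set y2 : Fin r → ℝ := y ∘ Sum.inr with hy2
    set x := fromCols Uq Ut *ᵥ y with hx
    have hWW : (Ω * fromCols Uq Ut)ᵀ * (Ω * fromCols Uq Ut) = 1 := by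
      ext i j
      have := congrFun (congrFun horth' (Sum.inl i)) (Sum.inl j)
      simpa [Matrix.mul_apply, Matrix.one_apply, fromCols_apply_inl] using this
    have hΩx : eNorm (Ω *ᵥ x) ^ 2 = y1 ⬝ᵥ y1 + y2 ⬝ᵥ y2 := by
      rw [eNorm_sq', hx, mulVec_mulVec, dotProduct_mulVec, ← mulVec_transpose,
        mulVec_mulVec, hWW, one_mulVec]
      simp [dotProduct, y1, y2]
    have hEx : E *ᵥ x = -((b ⬝ᵥ y1) • u) := by
      have : (b ᵥ* ((Ω * Uq)ᵀ * Ω)) ⬝ᵥ x = b ⬝ᵥ y1 := by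
        rw [hx, dotProduct_mulVec, hbU]
        simp [dotProduct, y1]
      rw [hE, neg_mulVec, ← this]
      ext i
      simp [Matrix.mulVec, vecMulVec_apply, dotProduct, Finset.mul_sum, mul_comm, mul_left_comm]
    have hEn : eNorm (E *ᵥ x) ^ 2 = (b ⬝ᵥ y1) ^ 2 * eNorm u ^ 2 := by
      rw [eNorm_sq', eNorm_sq', hEx]
      simp; ring
    have hcs : (b ⬝ᵥ y1) ^ 2 ≤ (b ⬝ᵥ b) * (y1 ⬝ᵥ y1) := by
      simpa [dotProduct, sq] using Finset.sum_mul_sq_le_sq_mul_sq Finset.univ b y1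
    have hbb : b ⬝ᵥ b ≤ q * η ^ 2 := by
      calc b ⬝ᵥ b ≤ ∑ _i : Fin q, η ^ 2 := by
            refine Finset.sum_le_sum fun i _ => ?_
            have := hη i
            rw [← abs_mul_abs_self, sq]
            exact mul_self_le_mul_self (abs_nonneg _) this
        _ = _ := by simp
    have hy1n : y1 ⬝ᵥ y1 ≤ (1 + ε) * eNorm x ^ 2 := by
      have : 0 ≤ y2 ⬝ᵥ y2 := Finset.sum_nonneg fun i _ => mul_self_nonneg _
      linarith
    have h0 : 0 ≤ y1 ⬝ᵥ y1 := Finset.sum_nonneg fun i _ => mul_self_nonneg _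
    have h1 : 0 < 1 - ε := by linarith
    have hu : eNorm u ^ 2 ≤ 1 / (1 - ε) := by
      rw [le_div_iff₀ h1]; linarith
    have hrhs : 0 ≤ Real.sqrt q * Real.sqrt ((1 + ε) / (1 - ε)) * η * eNorm x := by
      rcases Nat.eq_zero_or_pos q with h | h
      · subst h; simp
      · have : 0 ≤ η := (abs_nonneg _).trans (hη ⟨0, h⟩)
        have := eNorm_nonneg' x
        positivity
    apply (sq_le_sq₀ (eNorm_nonneg' _) hrhs).1
    rw [hEn, mul_pow, mul_pow, mul_pow, Real.sq_sqrt (by positivity), Real.sq_sqrt (by positivity)]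
    calc (b ⬝ᵥ y1) ^ 2 * eNorm u ^ 2
        ≤ ((q * η ^ 2) * ((1 + ε) * eNorm x ^ 2)) * (1 / (1 - ε)) := by
          gcongr
          exact hcs.trans (by gcongr)
      _ = _ := by ring
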